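/- arXiv:2009.01656 — 2 statements merged into one kernel-verified Lean document; each statement's English description precedes it below -/
import Mathlib

section
/- Let Δ be the triangle in the plane with vertices A = (a₁,a₂), B = (0,0), C = (c₁,0), where a₂ > 0 and c₁ > 0. Fix δ ∈ (0,a₂) and let Δ_δ = {x ∈ Δ : dist(x, BC) > δ}, where BC denotes the segment on the x-axis. Define T(t) = t + √(t²−1) for t ≥ 1. Then for every polynomial v of degree at most p in each variable, ‖v‖_{L²(Δ)} ≤ T((1 + δ/a₂)/(1 − δ/a₂))^{2p + 3/2} ‖v‖_{L²(Δ_δ)}. -/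
open MeasureTheory

open Polynomial in
/-- The Legendre polynomials, defined by Bonnet's recursion. -/
noncomputable def legendrePoly : ℕ → ℝ[X]
  | 0 => 1
  | 1 => X
  | k + 2 => C ((2 * k + 3 : ℝ) / (k + 2)) * (X * legendrePoly (k + 1)) -
      C ((k + 1 : ℝ) / (k + 2)) * legendrePoly k

namespace legendrePoly

open Polynomial

theorem bonnet (k : ℕ) :
    C (k + 2 : ℝ) * legendrePoly (k + 2) =
      C (2 * k + 3 : ℝ) * (X * legendrePoly (k + 1)) - C (k + 1 : ℝ) * legendrePoly k := by
  have h : (k + 2 : ℝ) ≠ 0 := by positivity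
  rw [legendrePoly, mul_sub, ← mul_assoc (C _) (C _), ← mul_assoc (C _) (C _), ← C_mul, ← C_mul,
    mul_div_cancel₀ _ h, mul_div_cancel₀ _ h]

theorem derivative_succ_aux (k : ℕ) :
    derivative (legendrePoly (k + 1)) =
        X * derivative (legendrePoly k) + C (k + 1 : ℝ) * legendrePoly k ∧
      X * derivative (legendrePoly (k + 1)) =
        derivative (legendrePoly k) + C (k + 1 : ℝ) * legendrePoly (k + 1) := by
  induction k with
  | zero => simp [legendrePoly]
  | succ k ih =>
    obtain ⟨hA, hB⟩ := ih
    have hrec := bonnet k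
    have hder := congrArg derivative hrec
    have hk : C (k + 2 : ℝ) ≠ 0 := by
      rw [Ne, C_eq_zero]; positivity
    simp only [derivative_mul, derivative_sub, derivative_C, derivative_X, zero_mul,
      zero_add, one_mul] at hder
    simp only [map_add, map_mul, map_natCast, map_ofNat, map_one, Nat.cast_add, Nat.cast_one]
      at hA hB hrec hder hk ⊢
    have hA' : derivative (legendrePoly (k + 1 + 1)) =
        X * derivative (legendrePoly (k + 1)) + ((k : ℝ[X]) + 1 + 1) * legendrePoly (k + 1) := by
      apply mul_left_cancel₀ hk
      linear_combination hder + ((k : ℝ[X]) + 1) * hB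
    refine ⟨hA', ?_⟩
    linear_combination X * hA' + X * hB - hA - hrec

theorem derivative_succ (k : ℕ) :
    derivative (legendrePoly (k + 1)) =
      X * derivative (legendrePoly k) + C (k + 1 : ℝ) * legendrePoly k :=
  (derivative_succ_aux k).1

theorem X_mul_derivative_succ (k : ℕ) :
    X * derivative (legendrePoly (k + 1)) =
      derivative (legendrePoly k) + C (k + 1 : ℝ) * legendrePoly (k + 1) :=
  (derivative_succ_aux k).2

/-- Legendre's differential equation. -/
theorem derivative_one_sub_sq_mul_derivative (k : ℕ) :
    derivative ((1 - X ^ 2) * derivative (legendrePoly k)) =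
      -(C (k * (k + 1) : ℝ) * legendrePoly k) := by
  cases k with
  | zero => simp [legendrePoly]
  | succ k =>
    have hA := derivative_succ k
    have hB := X_mul_derivative_succ k
    have h : (1 - X ^ 2) * derivative (legendrePoly (k + 1)) =
        C (k + 1 : ℝ) * (legendrePoly k - X * legendrePoly (k + 1)) := by
      linear_combination hA - X * hB
    rw [h]
    simp only [derivative_mul, derivative_sub, derivative_C, derivative_X, zero_mul,
      zero_add, one_mul]
    simp only [map_add, map_mul, map_natCast, map_one, Nat.cast_add, Nat.cast_one]
      at hB ⊢
    linear_combination -((k : ℝ[X]) + 1) * hB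

theorem integral_derivative (p : ℝ[X]) (a b : ℝ) :
    ∫ x in a..b, (derivative p).eval x = p.eval b - p.eval a :=
  intervalIntegral.integral_eq_sub_of_hasDerivAt (fun x _ => p.hasDerivAt x)
    ((derivative p).continuous.intervalIntegrable _ _)

/-- Integration of polynomials over `[-1, 1]`. -/
noncomputable def integralMap : ℝ[X] →ₗ[ℝ] ℝ where
  toFun p := ∫ x in (-1 : ℝ)..1, p.eval x
  map_add' p q := by
    simp only [eval_add]
    exact intervalIntegral.integral_add (p.continuous.intervalIntegrable _ _)
      (q.continuous.intervalIntegrable _ _)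
  map_smul' a p := by simp

theorem integralMap_C_mul (a : ℝ) (p : ℝ[X]) :
    integralMap (C a * p) = a * integralMap p := by
  rw [← smul_eq_C_mul, map_smul, smul_eq_mul]

theorem integralMap_mul_of_ne {j k : ℕ} (hjk : j ≠ k) :
    integralMap (legendrePoly j * legendrePoly k) = 0 := by
  have hj := derivative_one_sub_sq_mul_derivative j
  have hk := derivative_one_sub_sq_mul_derivative k
  have hD : derivative ((1 - X ^ 2) * derivative (legendrePoly j) * legendrePoly k -
      (1 - X ^ 2) * derivative (legendrePoly k) * legendrePoly j) =
      C ((k * (k + 1) : ℝ) - j * (j + 1)) * (legendrePoly j * legendrePoly k) := by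
    rw [derivative_sub, derivative_mul, derivative_mul (f := (1 - X ^ 2) * _), hj, hk, C_sub]
    ring
  have h0 : integralMap (C ((k * (k + 1) : ℝ) - j * (j + 1)) *
      (legendrePoly j * legendrePoly k)) = 0 := by
    rw [← hD]
    refine (integral_derivative _ _ _).trans ?_
    simp
  rw [integralMap_C_mul] at h0
  refine (mul_eq_zero.1 h0).resolve_left ?_
  have hne : (k : ℝ) - j ≠ 0 := sub_ne_zero.2 (by exact_mod_cast hjk.symm)
  have : (k * (k + 1) : ℝ) - j * (j + 1) = (k - j) * (k + j + 1) := by ring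
  rw [this]
  exact mul_ne_zero hne (by positivity)

theorem integralMap_sq (k : ℕ) :
    integralMap (legendrePoly k * legendrePoly k) = 2 / (2 * k + 1) := by
  have h01 : integralMap (legendrePoly 0 * legendrePoly 0) = 2 / (2 * (0 : ℕ) + 1) ∧
      integralMap (legendrePoly 1 * legendrePoly 1) = 2 / (2 * (1 : ℕ) + 1) := by
    constructor
    · simp [integralMap, legendrePoly]; norm_num
    · simp [integralMap, legendrePoly, ← sq]; norm_num
  induction k with
  | zero => exact h01.1
  | succ k ih =>
    cases k with
    | zero => exact h01.2
    | succ k =>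
      have h1 := congrArg (fun p => integralMap (p * legendrePoly (k + 2))) (bonnet k)
      have h2 := congrArg (fun p => integralMap (p * legendrePoly (k + 1))) (bonnet (k + 1))
      simp only [sub_mul, mul_assoc, map_sub, integralMap_C_mul] at h1 h2
      rw [integralMap_mul_of_ne (show k ≠ k + 2 by omega)] at h1
      rw [integralMap_mul_of_ne (show k + 1 + 2 ≠ k + 1 by omega), ih,
        mul_comm (legendrePoly (k + 1 + 1))] at h2
      change _ = _ * integralMap (X * (legendrePoly (k + 1) * legendrePoly (k + 2))) - _ at h2
      push_cast at h1 h2 ⊢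
      have e : (2 * ((k : ℝ) + 1) + 1) ≠ 0 := by positivity
      have e1 : (2 * (k : ℝ) + 3) ≠ 0 := by positivity
      have e2 : (k : ℝ) + 2 ≠ 0 := by positivity
      have e3 : (2 * ((k : ℝ) + 1 + 1) + 1) ≠ 0 := by positivity
      change integralMap (legendrePoly (k + 2) * legendrePoly (k + 2)) = _
      generalize integralMap (legendrePoly (k + 2) * legendrePoly (k + 2)) = N at *
      generalize integralMap (X * (legendrePoly (k + 1) * legendrePoly (k + 2))) = J at *
      field_simp at h1 h2 ⊢
      apply mul_left_cancel₀ e2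
      linear_combination (2 * ((k : ℝ) + 1 + 1) + 1) * h1 - h2

theorem eval_mono_and_le {y : ℝ} (hy : 1 ≤ y) (k : ℕ) :
    0 ≤ (legendrePoly k).eval ((y + y⁻¹) / 2) ∧
      (legendrePoly k).eval ((y + y⁻¹) / 2) ≤ (legendrePoly (k + 1)).eval ((y + y⁻¹) / 2) ∧
      (legendrePoly (k + 1)).eval ((y + y⁻¹) / 2) ≤
        y * (legendrePoly k).eval ((y + y⁻¹) / 2) := by
  have hy0 : 0 < y := by linarith
  have hyi : y * y⁻¹ = 1 := mul_inv_cancel₀ hy0.ne'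
  have hy1 : y⁻¹ ≤ 1 := inv_le_one_of_one_le₀ hy
  have hyi0 : 0 < y⁻¹ := inv_pos.2 hy0
  have hx : 1 ≤ (y + y⁻¹) / 2 := by nlinarith [sq_nonneg (y - 1)]
  induction k with
  | zero =>
    simp only [legendrePoly, eval_one, eval_X]
    exact ⟨zero_le_one, hx, by linarith⟩
  | succ k ih =>
    obtain ⟨h0, h1, h2⟩ := ih
    have hrec := congrArg (eval ((y + y⁻¹) / 2)) (bonnet k)
    simp only [eval_mul, eval_sub, eval_C, eval_X] at hrec
    change _ ∧ _ ≤ (legendrePoly (k + 2)).eval _ ∧ (legendrePoly (k + 2)).eval _ ≤ _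
    generalize (legendrePoly k).eval ((y + y⁻¹) / 2) = a at *
    generalize (legendrePoly (k + 1)).eval ((y + y⁻¹) / 2) = b at *
    generalize (legendrePoly (k + 2)).eval ((y + y⁻¹) / 2) = c at *
    have hb : 0 ≤ b := h0.trans h1
    have hk : (0 : ℝ) < k + 2 := by positivity
    have hk1 : (0 : ℝ) ≤ k + 1 := by positivity
    have hk3 : (0 : ℝ) ≤ 2 * k + 3 := by positivity
    refine ⟨hb, ?_, ?_⟩
    · have h3 : b ≤ (y + y⁻¹) / 2 * b := by nlinarith
      have h4 := mul_le_mul_of_nonneg_left h3 hk3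
      have h5 := mul_le_mul_of_nonneg_left h1 hk1
      exact le_of_mul_le_mul_left (by linarith) hk
    · have h3 : y⁻¹ * b ≤ a := by
        have := mul_le_mul_of_nonneg_left h2 hyi0.le
        rwa [← mul_assoc, mul_comm y⁻¹ y, hyi, one_mul] at this
      have h5 := mul_le_mul_of_nonneg_left h3 hk1
      have h6 : y⁻¹ * b ≤ y * b := mul_le_mul_of_nonneg_right (by linarith) hb
      refine le_of_mul_le_mul_left ?_ hk
      rw [hrec]
      nlinarith

theorem eval_sq_le {y : ℝ} (hy : 1 ≤ y) (k : ℕ) :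
    (legendrePoly k).eval ((y + y⁻¹) / 2) ^ 2 ≤ y ^ (2 * k) := by
  have h : (legendrePoly k).eval ((y + y⁻¹) / 2) ≤ y ^ k := by
    induction k with
    | zero => simp [legendrePoly]
    | succ k ih =>
      refine (eval_mono_and_le hy k).2.2.trans ?_
      rw [pow_succ']
      exact mul_le_mul_of_nonneg_left ih (by linarith)
  rw [mul_comm, pow_mul]
  exact pow_le_pow_left₀ (eval_mono_and_le hy k).1 h 2

theorem X_mul_mem_span {m : ℕ} {p : ℝ[X]}
    (hp : p ∈ Submodule.span ℝ (legendrePoly '' (Finset.range m : Set ℕ))) :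
    X * p ∈ Submodule.span ℝ (legendrePoly '' (Finset.range (m + 1) : Set ℕ)) := by
  induction hp using Submodule.span_induction with
  | mem p hp =>
    obtain ⟨k, hk, rfl⟩ := hp
    have hk : k < m := by simpa using hk
    have mem : ∀ j, j ≤ m → legendrePoly j ∈
        Submodule.span ℝ (legendrePoly '' (Finset.range (m + 1) : Set ℕ)) := fun j hj =>
      Submodule.subset_span ⟨j, by simpa using Nat.lt_succ_of_le hj, rfl⟩
    cases k with
    | zero => simpa [legendrePoly] using mem 1 hk
    | succ k =>
      have h3 : (2 * k + 3 : ℝ) ≠ 0 := by positivity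
      have key : (2 * k + 3 : ℝ) • (X * legendrePoly (k + 1)) =
          (k + 2 : ℝ) • legendrePoly (k + 2) + (k + 1 : ℝ) • legendrePoly k := by
        simp only [smul_eq_C_mul]
        linear_combination -bonnet k
      rw [← Submodule.smul_mem_iff _ h3, key]
      exact add_mem (Submodule.smul_mem _ _ (mem _ hk)) (Submodule.smul_mem _ _ (mem _ (by omega)))
  | zero => simp
  | add p q _ _ hp hq => rw [mul_add]; exact add_mem hp hq
  | smul a p _ hp => rw [mul_smul_comm]; exact Submodule.smul_mem _ _ hp

theorem mem_span_of_natDegree_le {m : ℕ} {p : ℝ[X]} (hp : p.natDegree ≤ m) :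
    p ∈ Submodule.span ℝ (legendrePoly '' (Finset.range (m + 1) : Set ℕ)) := by
  have const : ∀ (m : ℕ) (a : ℝ), C a ∈
      Submodule.span ℝ (legendrePoly '' (Finset.range (m + 1) : Set ℕ)) := fun m a => by
    have : C a = a • legendrePoly 0 := by simp [legendrePoly, smul_eq_C_mul]
    rw [this]
    exact Submodule.smul_mem _ _ (Submodule.subset_span ⟨0, by simp, rfl⟩)
  induction m generalizing p with
  | zero =>
    rw [eq_C_of_natDegree_le_zero hp]
    exact const 0 _
  | succ m ih =>
    rw [← divX_mul_X_add p, mul_comm]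
    refine add_mem (X_mul_mem_span (ih ?_)) (const _ _)
    rw [natDegree_divX_eq_natDegree_tsub_one]
    omega

/-- A pointwise bound for a polynomial outside `[-1, 1]` by its `L²` norm on `[-1, 1]`. -/
theorem eval_sq_le_integral {m : ℕ} {p : ℝ[X]} (hp : p.natDegree ≤ m) {y : ℝ} (hy : 1 ≤ y) :
    p.eval ((y + y⁻¹) / 2) ^ 2 ≤
      (∑ k ∈ Finset.range (m + 1), (2 * k + 1) * y ^ (2 * k)) / 2 *
        ∫ x in (-1 : ℝ)..1, p.eval x ^ 2 := by
  obtain ⟨c, hc⟩ : ∃ c : ℕ → ℝ, ∑ k ∈ Finset.range (m + 1), c k • legendrePoly k = p :=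
    (Submodule.mem_span_image_finset_iff_exists_fun' ℝ).1 (mem_span_of_natDegree_le hp)
  have hint : ∫ x in (-1 : ℝ)..1, p.eval x ^ 2 =
      ∑ k ∈ Finset.range (m + 1), c k ^ 2 * (2 / (2 * k + 1)) := by
    have : ∫ x in (-1 : ℝ)..1, p.eval x ^ 2 = integralMap (p * p) := by
      simp [integralMap, sq]
    rw [this, ← hc, Finset.sum_mul_sum, map_sum]
    refine Finset.sum_congr rfl fun k hk => ?_
    rw [map_sum, Finset.sum_eq_single_of_mem k hk]
    · rw [smul_mul_smul_comm, map_smul, integralMap_sq, smul_eq_mul, sq]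
    · intro j _ hj
      rw [smul_mul_smul_comm, map_smul, integralMap_mul_of_ne hj.symm, smul_zero]
  have heval : p.eval ((y + y⁻¹) / 2) =
      ∑ k ∈ Finset.range (m + 1), c k * (legendrePoly k).eval ((y + y⁻¹) / 2) := by
    rw [← hc, eval_finsetSum]
    simp
  rw [hint, heval, Finset.sum_div, mul_comm]
  refine (Finset.sum_sq_le_sum_mul_sum_of_sq_le_mul (Finset.range (m + 1))
    (f := fun k => c k ^ 2 * (2 / (2 * k + 1)))
    (g := fun k => (2 * k + 1) / 2 * (legendrePoly k).eval ((y + y⁻¹) / 2) ^ 2) ?_ ?_ ?_).trans ?_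
  · intro k _; positivity
  · intro k _; positivity
  · intro k _; exact le_of_eq (by field_simp)
  · refine mul_le_mul_of_nonneg_left (Finset.sum_le_sum fun k _ => ?_)
      (Finset.sum_nonneg fun k _ => by positivity)
    have := mul_le_mul_of_nonneg_left (eval_sq_le hy k) (show (0 : ℝ) ≤ (2 * k + 1) / 2 by positivity)
    linarith

end legendrePoly

theorem sum_range_odd_mul_pow_le {y : ℝ} (hy : 1 ≤ y) (m : ℕ) :
    (∑ k ∈ Finset.range (m + 1), (2 * k + 1) * y ^ (2 * k)) * (1 - (y ^ 2)⁻¹) ≤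
      (2 * m + 1) * y ^ (2 * m) := by
  have hy0 : 0 < y := by linarith
  induction m with
  | zero => simpa using sq_nonneg y
  | succ m ih =>
    rw [Finset.sum_range_succ, add_mul]
    have h : y ^ (2 * (m + 1)) * (1 - (y ^ 2)⁻¹) = y ^ (2 * (m + 1)) - y ^ (2 * m) := by
      have : y ^ (2 * (m + 1)) = y ^ (2 * m) * y ^ 2 := by ring
      rw [this]; field_simp
    rw [mul_assoc, h]
    have := pow_pos hy0 (2 * m)
    push_cast
    linarith

/-- A one-dimensional domain inverse estimate with the weight `1 + x`. -/
theorem integral_one_add_mul_sq_le {n : ℕ} {q : Polynomial ℝ} (hq : q.natDegree ≤ n)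
    {T : ℝ} (hT : 1 ≤ T) :
    ∫ x in (-1 : ℝ)..((T + T⁻¹) / 2), (1 + x) * q.eval x ^ 2 ≤
      T ^ (2 * n + 3) * ∫ x in (-1 : ℝ)..1, (1 + x) * q.eval x ^ 2 := by
  have hcont : Continuous fun x : ℝ => (1 + x) * q.eval x ^ 2 := by fun_prop
  set Φ := ∫ x in (-1 : ℝ)..1, (1 + x) * q.eval x ^ 2 with hΦ
  have hΦ0 : 0 ≤ Φ := intervalIntegral.integral_nonneg (by norm_num) fun x hx =>
    mul_nonneg (by linarith [hx.1]) (sq_nonneg _)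
  have hdeg : ((1 + Polynomial.X) * q).natDegree ≤ n + 1 := by
    refine Polynomial.natDegree_mul_le.trans ?_
    have : (1 + Polynomial.X : Polynomial ℝ).natDegree ≤ 1 := by
      rw [add_comm]; exact (Polynomial.natDegree_X_add_C (1 : ℝ)).le
    omega
  have hL2 : ∫ x in (-1 : ℝ)..1, ((1 + Polynomial.X) * q).eval x ^ 2 ≤ 2 * Φ := by
    rw [hΦ, ← intervalIntegral.integral_const_mul]
    refine intervalIntegral.integral_mono_on (by norm_num)
      (Continuous.intervalIntegrable (by fun_prop) _ _)
      (Continuous.intervalIntegrable (by fun_prop) _ _) fun x hx => ?_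
    simp only [Polynomial.eval_mul, Polynomial.eval_add, Polynomial.eval_one, Polynomial.eval_X]
    have h1 : 0 ≤ 1 + x := by linarith [hx.1]
    have h2 : 0 ≤ 1 - x := by linarith [hx.2]
    nlinarith [mul_nonneg (mul_nonneg h1 h2) (sq_nonneg (q.eval x))]
  have hpt : ∀ y ∈ Set.Icc 1 T,
      (1 + (y + y⁻¹) / 2) * q.eval ((y + y⁻¹) / 2) ^ 2 * ((1 - (y ^ 2)⁻¹) / 2) ≤
        Φ / 4 * ((2 * (n + 1 : ℕ) + 1) * y ^ (2 * (n + 1))) := by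
    intro y hy
    have hy0 : 0 < y := by linarith [hy.1]
    have hyi : y * y⁻¹ = 1 := mul_inv_cancel₀ hy0.ne'
    have hyi0 : 0 < y⁻¹ := inv_pos.2 hy0
    have hx : 1 ≤ (y + y⁻¹) / 2 := by nlinarith [sq_nonneg (y - 1)]
    have hinv : 0 ≤ 1 - (y ^ 2)⁻¹ := sub_nonneg.2 (inv_le_one_of_one_le₀ (one_le_pow₀ hy.1))
    have h1 := legendrePoly.eval_sq_le_integral hdeg hy.1
    have hS : 0 ≤ ∑ k ∈ Finset.range (n + 1 + 1), (2 * k + 1) * y ^ (2 * k) :=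
      Finset.sum_nonneg fun k _ => by positivity
    have h2 := h1.trans (mul_le_mul_of_nonneg_left hL2 (by linarith))
    have h3 := mul_le_mul_of_nonneg_left (sum_range_odd_mul_pow_le hy.1 (n + 1)) hΦ0
    simp only [Polynomial.eval_mul, Polynomial.eval_add, Polynomial.eval_one,
      Polynomial.eval_X] at h2
    have h4 : (1 + (y + y⁻¹) / 2) * q.eval ((y + y⁻¹) / 2) ^ 2 ≤
        (∑ k ∈ Finset.range (n + 1 + 1), (2 * k + 1) * y ^ (2 * k)) * Φ / 2 := by
      have h5 : 0 ≤ ((y + y⁻¹) / 2 - 1) * (1 + (y + y⁻¹) / 2) * q.eval ((y + y⁻¹) / 2) ^ 2 :=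
        mul_nonneg (mul_nonneg (by linarith) (by linarith)) (sq_nonneg _)
      nlinarith
    have h6 := mul_le_mul_of_nonneg_right h4 (show 0 ≤ (1 - (y ^ 2)⁻¹) / 2 by linarith)
    linarith
  have hne : ∀ y ∈ Set.uIcc 1 T, y ≠ 0 := fun y hy => by
    rw [Set.uIcc_of_le hT] at hy
    exact (zero_lt_one.trans_le hy.1).ne'
  have hcinv : ContinuousOn (fun y : ℝ => (1 - (y ^ 2)⁻¹) / 2) (Set.uIcc 1 T) :=
    (continuousOn_const.sub ((continuousOn_id.pow 2).inv₀ fun y hy =>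
      pow_ne_zero 2 (hne y hy))).div_const 2
  have hcx : ContinuousOn (fun y : ℝ => (y + y⁻¹) / 2) (Set.uIcc 1 T) :=
    (continuousOn_id.add (continuousOn_id.inv₀ hne)).div_const 2
  have hsub : ∫ y in (1 : ℝ)..T, ((fun x => (1 + x) * q.eval x ^ 2) ∘ fun y => (y + y⁻¹) / 2) y *
      ((1 - (y ^ 2)⁻¹) / 2) = ∫ x in (1 : ℝ)..((T + T⁻¹) / 2), (1 + x) * q.eval x ^ 2 := by
    have := intervalIntegral.integral_comp_mul_deriv (a := 1) (b := T)
      (f := fun y => (y + y⁻¹) / 2) (f' := fun y => (1 - (y ^ 2)⁻¹) / 2)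
      (g := fun x => (1 + x) * q.eval x ^ 2) (fun y hy => by
        simpa [sub_eq_add_neg] using ((hasDerivAt_id y).add (hasDerivAt_inv (hne y hy))).div_const 2)
      hcinv hcont
    simpa using this
  have htail : ∫ x in (1 : ℝ)..((T + T⁻¹) / 2), (1 + x) * q.eval x ^ 2 ≤
      Φ / 4 * (T ^ (2 * n + 3) - 1) := by
    have hpow : ∫ y in (1 : ℝ)..T, Φ / 4 * ((2 * (n + 1 : ℕ) + 1) * y ^ (2 * (n + 1))) =
        Φ / 4 * (T ^ (2 * n + 3) - 1) := by
      rw [intervalIntegral.integral_const_mul, intervalIntegral.integral_const_mul, integral_pow]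
      push_cast
      rw [one_pow, mul_div_cancel₀ _ (by positivity), show 2 * (n + 1) + 1 = 2 * n + 3 by ring]
    rw [← hsub, ← hpow]
    refine intervalIntegral.integral_mono_on hT
      (ContinuousOn.intervalIntegrable ((hcont.comp_continuousOn hcx).mul hcinv))
      (Continuous.intervalIntegrable (by fun_prop) _ _) hpt
  rw [← intervalIntegral.integral_add_adjacent_intervals (hcont.intervalIntegrable _ 1)
    (hcont.intervalIntegrable 1 _)]
  have hT1 : 1 ≤ T ^ (2 * n + 3) := one_le_pow₀ hT
  nlinarith

/-- A one-dimensional domain inverse estimate on `[0, η] ⊆ [0, 1]` with the weight `s`. -/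
theorem integral_mul_sq_le {n : ℕ} {q : Polynomial ℝ} (hq : q.natDegree ≤ n)
    {T η : ℝ} (hη : 0 < η) (hT : 1 ≤ T) (hTη : (T + T⁻¹) / 2 = 2 / η - 1) :
    ∫ s in (0 : ℝ)..1, s * q.eval s ^ 2 ≤
      T ^ (2 * n + 3) * ∫ s in (0 : ℝ)..η, s * q.eval s ^ 2 := by
  have hη2 : 0 < η / 2 := by positivity
  set r := q.comp (Polynomial.C (η / 2) * Polynomial.X + Polynomial.C (η / 2)) with hr
  have hdeg : r.natDegree ≤ n := by
    refine Polynomial.natDegree_comp_le.trans ?_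
    have := Polynomial.natDegree_linear_le (a := η / 2) (b := η / 2)
    nlinarith
  have hcov : ∀ t : ℝ, ∫ x in (-1 : ℝ)..t, (1 + x) * r.eval x ^ 2 =
      (η / 2)⁻¹ ^ 2 * ∫ s in (0 : ℝ)..(η / 2 * t + η / 2), s * q.eval s ^ 2 := by
    intro t
    have h := intervalIntegral.integral_comp_mul_add (a := -1) (b := t)
      (fun s => s * q.eval s ^ 2) hη2.ne' (η / 2)
    rw [show η / 2 * -1 + η / 2 = 0 by ring, smul_eq_mul] at h
    rw [sq, mul_assoc, ← h, ← intervalIntegral.integral_const_mul]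
    refine intervalIntegral.integral_congr fun x _ => ?_
    simp only [hr, Polynomial.eval_comp, Polynomial.eval_add, Polynomial.eval_mul,
      Polynomial.eval_C, Polynomial.eval_X]
    field_simp
    ring
  have h := integral_one_add_mul_sq_le hdeg hT
  rw [hcov, hcov, hTη, show η / 2 * (2 / η - 1) + η / 2 = 1 by field_simp; ring,
    show η / 2 * 1 + η / 2 = η by ring, mul_left_comm] at h
  exact le_of_mul_le_mul_left h (by positivity)

theorem exists_polynomial_eval_eq_eval_line (v : MvPolynomial (Fin 2) ℝ) {p : ℕ}
    (hv : ∀ i, v.degreeOf i ≤ p) (a b : Fin 2 → ℝ) :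
    ∃ q : Polynomial ℝ, q.natDegree ≤ 2 * p ∧
      ∀ s, q.eval s = MvPolynomial.eval (fun i => a i * (1 - s) + b i * s) v := by
  let L : Fin 2 → Polynomial ℝ := fun i =>
    Polynomial.C (b i - a i) * Polynomial.X + Polynomial.C (a i)
  refine ⟨∑ d ∈ v.support, Polynomial.C (v.coeff d) * ∏ i, L i ^ d i, ?_, fun s => ?_⟩
  · refine Polynomial.natDegree_sum_le_of_forall_le _ _ fun d hd => ?_
    have hL : ∀ i, (L i ^ d i).natDegree ≤ p := fun i => by
      refine Polynomial.natDegree_pow_le.trans ?_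
      have h1 := (MvPolynomial.monomial_le_degreeOf i hd).trans (hv i)
      have h2 : (L i).natDegree ≤ 1 := Polynomial.natDegree_linear_le
      nlinarith
    refine (Polynomial.natDegree_C_mul_le _ _).trans ?_
    rw [Fin.prod_univ_two]
    refine Polynomial.natDegree_mul_le.trans ?_
    linarith [hL 0, hL 1]
  · rw [Polynomial.eval_finsetSum, MvPolynomial.eval_eq']
    refine Finset.sum_congr rfl fun d _ => ?_
    rw [Polynomial.eval_mul, Polynomial.eval_C, Polynomial.eval_prod]
    congr 1
    refine Finset.prod_congr rfl fun i _ => ?_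
    simp only [L, Polynomial.eval_pow, Polynomial.eval_add, Polynomial.eval_mul,
      Polynomial.eval_C, Polynomial.eval_X]
    congr 1
    ring

/-- Fubini's theorem for the region between two graphs over a vertical slice. -/
theorem setIntegral_between_eq {g : ℝ × ℝ → ℝ} {l r : ℝ → ℝ} (hl : Measurable l)
    (hr : Measurable r) {H : Set ℝ} (hH : MeasurableSet H)
    (hg : IntegrableOn g {z | z.2 ∈ H ∧ z.1 ∈ Set.Icc (l z.2) (r z.2)}) :
    ∫ z in {z : ℝ × ℝ | z.2 ∈ H ∧ z.1 ∈ Set.Icc (l z.2) (r z.2)}, g z =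
      ∫ h in H, ∫ x in Set.Icc (l h) (r h), g (x, h) := by
  have hS : MeasurableSet {z : ℝ × ℝ | z.2 ∈ H ∧ z.1 ∈ Set.Icc (l z.2) (r z.2)} :=
    (measurable_snd hH).inter
      ((measurableSet_le (hl.comp measurable_snd) measurable_fst).inter
        (measurableSet_le measurable_fst (hr.comp measurable_snd)))
  rw [← integral_indicator hS, ← integral_indicator hH, Measure.volume_eq_prod,
    integral_prod_symm]
  · refine integral_congr_ae (Filter.Eventually.of_forall fun h => ?_)
    by_cases hh : h ∈ H
    · simp only [Set.indicator_of_mem hh]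
      rw [← integral_indicator measurableSet_Icc]
      refine integral_congr_ae (Filter.Eventually.of_forall fun x => ?_)
      by_cases hx : x ∈ Set.Icc (l h) (r h)
      · rw [Set.indicator_of_mem hx]
        exact Set.indicator_of_mem (a := (x, h))
          (s := {z | z.2 ∈ H ∧ z.1 ∈ Set.Icc (l z.2) (r z.2)}) ⟨hh, hx⟩ g
      · rw [Set.indicator_of_notMem hx]
        exact Set.indicator_of_notMem (fun hz => hx hz.2) g
    · simp [hh]
  · rw [← Measure.volume_eq_prod]
    exact hg.integrable_indicator hS

/-- Integration over (a truncation of) a triangle in coordinates centred at the apex. -/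
theorem intervalIntegral_triangle_eq {g : ℝ × ℝ → ℝ} (hg : Continuous g) {a₁ a₂ c₁ : ℝ}
    (ha₂ : 0 < a₂) (τ : ℝ) :
    ∫ h in τ..a₂, ∫ x in (a₁ * (h / a₂))..(a₁ * (h / a₂) + c₁ * (1 - h / a₂)), g (x, h) =
      a₂ * ∫ y in (0 : ℝ)..c₁, ∫ s in (0 : ℝ)..(1 - τ / a₂),
        s * g (a₁ * (1 - s) + y * s, a₂ * (1 - s)) := by
  have hswap := intervalIntegral_intervalIntegral_swap (a := 0) (b := c₁) (c := 0)
    (d := 1 - τ / a₂) (F := fun y s : ℝ => s * g (a₁ * (1 - s) + y * s, a₂ * (1 - s)))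
    (((by fun_prop : Continuous (Function.uncurry
      fun y s : ℝ => s * g (a₁ * (1 - s) + y * s, a₂ * (1 - s)))).integrableOn_Icc
        (a := ((min 0 c₁ : ℝ), (min 0 (1 - τ / a₂) : ℝ)))
        (b := ((max 0 c₁ : ℝ), (max 0 (1 - τ / a₂) : ℝ)))).mono_set (by
          rw [← Set.Icc_prod_Icc]
          exact Set.prod_mono Set.Ioc_subset_Icc_self Set.Ioc_subset_Icc_self))
  rw [hswap]
  have h1 := intervalIntegral.mul_integral_comp_sub_mul (a := 0) (b := 1 - τ / a₂)
    (f := fun h => ∫ x in (a₁ * (h / a₂))..(a₁ * (h / a₂) + c₁ * (1 - h / a₂)), g (x, h))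
    (c := a₂) (d := a₂)
  rw [show a₂ - a₂ * (1 - τ / a₂) = τ by field_simp; ring, mul_zero, sub_zero] at h1
  rw [← h1]
  congr 1
  refine intervalIntegral.integral_congr fun s _ => ?_
  have hs : (a₂ - a₂ * s) / a₂ = 1 - s := by field_simp
  have h2 := intervalIntegral.mul_integral_comp_mul_add (a := 0) (b := c₁)
    (f := fun x => g (x, a₂ - a₂ * s)) (c := s) (d := a₁ * (1 - s))
  simp only [hs, sub_sub_cancel]
  rw [show s * 0 + a₁ * (1 - s) = a₁ * (1 - s) by ring,
    show s * c₁ + a₁ * (1 - s) = a₁ * (1 - s) + c₁ * s by ring] at h2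
  rw [← h2, ← intervalIntegral.integral_const_mul]
  refine intervalIntegral.integral_congr fun y _ => ?_
  rw [show s * y + a₁ * (1 - s) = a₁ * (1 - s) + y * s by ring,
    show a₂ - a₂ * s = a₂ * (1 - s) by ring]

theorem mem_convexHull_triangle_iff {a₁ a₂ c₁ : ℝ} (ha₂ : 0 < a₂) (hc₁ : 0 < c₁)
    {A B C : EuclideanSpace ℝ (Fin 2)}
    (hA0 : A 0 = a₁) (hA1 : A 1 = a₂) (hB : B = 0) (hC0 : C 0 = c₁) (hC1 : C 1 = 0)
    (x : EuclideanSpace ℝ (Fin 2)) :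
    x ∈ convexHull ℝ ({A, B, C} : Set (EuclideanSpace ℝ (Fin 2))) ↔
      x 1 ∈ Set.Icc 0 a₂ ∧
        x 0 ∈ Set.Icc (a₁ * (x 1 / a₂)) (a₁ * (x 1 / a₂) + c₁ * (1 - x 1 / a₂)) := by
  rw [convexHull_insert (Set.insert_nonempty _ _), convexHull_pair, mem_convexJoin]
  simp only [Set.mem_singleton_iff, exists_eq_left]
  constructor
  · rintro ⟨_, ⟨u, w, hu, hw, huw, rfl⟩, α, β, hα, hβ, hαβ, rfl⟩
    have h1 : (α • A + β • (u • B + w • C)) 1 = α * a₂ := by simp [hA1, hB, hC1]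
    have h0 : (α • A + β • (u • B + w • C)) 0 = α * a₁ + β * (w * c₁) := by
      simp [hA0, hB, hC0]
    rw [h1, h0, mul_div_cancel_right₀ _ ha₂.ne']
    have hβ' : 1 - α = β := by linarith
    have hw1 : w ≤ 1 := by linarith
    rw [hβ']
    refine ⟨⟨by positivity, by nlinarith⟩, ?_, ?_⟩
    · have : 0 ≤ β * (w * c₁) := by positivity
      linarith
    · have : β * (w * c₁) ≤ β * (1 * c₁) := by gcongr
      linarith
  · rintro ⟨⟨h0, h1⟩, h2, h3⟩
    set α := x 1 / a₂ with hα
    have hx1 : x 1 = α * a₂ := by rw [hα]; field_simp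
    have hα0 : 0 ≤ α := by positivity
    have hα1 : α ≤ 1 := (div_le_one ha₂).2 h1
    rcases hα1.eq_or_lt with h | h
    · refine ⟨B, left_mem_segment _ _ _, ?_⟩
      rw [h] at h2 h3 hx1
      have : x = A := by
        ext i
        fin_cases i
        · simp only [Fin.zero_eta, hA0]; linarith
        · simp only [Fin.mk_one, hA1]; linarith
      rw [this]
      exact left_mem_segment _ _ _
    · have h4 : 0 < 1 - α := by linarith
      set w := (x 0 - a₁ * α) / (c₁ * (1 - α)) with hw
      have hw0 : 0 ≤ w := div_nonneg (by linarith) (by positivity)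
      have hw1 : w ≤ 1 := (div_le_one (by positivity)).2 (by linarith)
      have hwx : w * (c₁ * (1 - α)) = x 0 - a₁ * α := by rw [hw]; field_simp
      refine ⟨(1 - w) • B + w • C, ⟨1 - w, w, by linarith, hw0, by ring, rfl⟩, α, 1 - α, hα0,
        h4.le, by ring, ?_⟩
      ext i
      fin_cases i
      · simp [hA0, hB, hC0]; linarith
      · simp [hA1, hB, hC1]; linarith

/-- The coordinates of a point of the Euclidean plane, as a measurable equivalence. -/
noncomputable def euclideanPlaneEquivProd : EuclideanSpace ℝ (Fin 2) ≃ᵐ ℝ × ℝ :=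
  (MeasurableEquiv.toLp 2 (Fin 2 → ℝ)).symm.trans MeasurableEquiv.finTwoArrow

theorem measurePreserving_euclideanPlaneEquivProd :
    MeasurePreserving euclideanPlaneEquivProd volume volume :=
  (volume_preserving_finTwoArrow ℝ).comp
    (EuclideanSpace.volume_preserving_symm_measurableEquiv_toLp (Fin 2))

theorem setIntegral_triangle_slab_eq {g : ℝ × ℝ → ℝ} (hg : Continuous g) {a₁ a₂ c₁ : ℝ}
    (ha₂ : 0 < a₂) (hc₁ : 0 < c₁) {H : Set ℝ} (hH : MeasurableSet H) (hHa : H ⊆ Set.Icc 0 a₂) :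
    ∫ x in {x : EuclideanSpace ℝ (Fin 2) | x 1 ∈ H ∧
        x 0 ∈ Set.Icc (a₁ * (x 1 / a₂)) (a₁ * (x 1 / a₂) + c₁ * (1 - x 1 / a₂))},
        g (x 0, x 1) =
      ∫ h in H, ∫ x in (a₁ * (h / a₂))..(a₁ * (h / a₂) + c₁ * (1 - h / a₂)), g (x, h) := by
  have h1 := measurePreserving_euclideanPlaneEquivProd.setIntegral_preimage_emb
    euclideanPlaneEquivProd.measurableEmbedding g {z : ℝ × ℝ | z.2 ∈ H ∧
      z.1 ∈ Set.Icc (a₁ * (z.2 / a₂)) (a₁ * (z.2 / a₂) + c₁ * (1 - z.2 / a₂))}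
  refine Eq.trans h1 ?_
  rw [setIntegral_between_eq (g := g) (l := fun h => a₁ * (h / a₂))
    (r := fun h => a₁ * (h / a₂) + c₁ * (1 - h / a₂)) (by fun_prop) (by fun_prop) hH]
  · refine setIntegral_congr_fun hH fun h hh => ?_
    have : h / a₂ ≤ 1 := (div_le_one ha₂).2 (hHa hh).2
    have h2 : 0 ≤ c₁ * (1 - h / a₂) := mul_nonneg hc₁.le (by linarith)
    rw [integral_Icc_eq_integral_Ioc, intervalIntegral.integral_of_le (by linarith)]
  · refine (hg.integrableOn_Icc (a := ((-|a₁| : ℝ), (0 : ℝ)))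
      (b := ((|a₁| + c₁ : ℝ), a₂))).mono_set ?_
    rintro ⟨x, h⟩ ⟨hh, hx1, hx2⟩
    rw [← Set.Icc_prod_Icc]
    refine ⟨?_, hHa hh⟩
    change h ∈ H at hh
    change a₁ * (h / a₂) ≤ x at hx1
    change x ≤ a₁ * (h / a₂) + c₁ * (1 - h / a₂) at hx2
    have h0 : 0 ≤ h / a₂ := div_nonneg (hHa hh).1 ha₂.le
    have h1 : h / a₂ ≤ 1 := (div_le_one ha₂).2 (hHa hh).2
    have h2 := abs_le.1 (show |a₁ * (h / a₂)| ≤ |a₁| by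
      rw [abs_mul, abs_of_nonneg h0]
      exact mul_le_of_le_one_right (abs_nonneg _) h1)
    constructor
    · change -|a₁| ≤ x; linarith [h2.1]
    · change x ≤ |a₁| + c₁; nlinarith [h2.2]

/-- Two-dimensional domain inverse estimate (Lemma 2.3): for the triangle `Δ` with vertices
`A = (a₁,a₂)`, `B = (0,0)`, `C = (c₁,0)` with `a₂, c₁ > 0`, `δ ∈ (0,a₂)`, and
`Δ_δ = {x ∈ Δ : dist(x,BC) > δ}`, every polynomial `v` of degree at most `p` in each
variable satisfies `‖v‖_{L²(Δ)} ≤ T((1+δ/a₂)/(1−δ/a₂))^{2p+3/2} ‖v‖_{L²(Δ_δ)}`,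
where `T(t) = t + √(t²−1)`. -/
theorem domain_inverse_estimate_2d (p : ℕ) (a₁ a₂ c₁ δ : ℝ) (ha₂ : 0 < a₂) (hc₁ : 0 < c₁)
    (hδ : δ ∈ Set.Ioo 0 a₂)
    (A B C : EuclideanSpace ℝ (Fin 2))
    (hA0 : A 0 = a₁) (hA1 : A 1 = a₂) (hB : B = 0) (hC0 : C 0 = c₁) (hC1 : C 1 = 0)
    (v : MvPolynomial (Fin 2) ℝ) (hv : ∀ i, v.degreeOf i ≤ p) :
    (∫ x in convexHull ℝ ({A, B, C} : Set (EuclideanSpace ℝ (Fin 2))),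
        (MvPolynomial.eval (fun i => x i) v) ^ 2) ^ ((1:ℝ)/2) ≤
      ((1 + δ / a₂) / (1 - δ / a₂) +
          Real.sqrt (((1 + δ / a₂) / (1 - δ / a₂)) ^ 2 - 1)) ^ ((2 * p : ℝ) + 3/2) *
        (∫ x in {x ∈ convexHull ℝ ({A, B, C} : Set (EuclideanSpace ℝ (Fin 2))) |
            δ < Metric.infDist x (segment ℝ B C)},
          (MvPolynomial.eval (fun i => x i) v) ^ 2) ^ ((1:ℝ)/2) := by
  have hδ0 := hδ.1
  have hd0 : 0 < δ / a₂ := div_pos hδ0 ha₂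
  have hd1 : δ / a₂ < 1 := (div_lt_one ha₂).2 hδ.2
  have hη : 0 < 1 - δ / a₂ := by linarith
  set t := (1 + δ / a₂) / (1 - δ / a₂) with ht
  have ht1 : 1 ≤ t := (one_le_div hη).2 (by linarith)
  have hsqrt := Real.sq_sqrt (show 0 ≤ t ^ 2 - 1 by nlinarith)
  have hsqrt0 := Real.sqrt_nonneg (t ^ 2 - 1)
  set T := t + Real.sqrt (t ^ 2 - 1) with hT
  have hT1 : 1 ≤ T := by linarith
  have hTinv : T⁻¹ = t - Real.sqrt (t ^ 2 - 1) :=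
    inv_eq_of_mul_eq_one_right (by rw [hT]; linarith)
  have hTη : (T + T⁻¹) / 2 = 2 / (1 - δ / a₂) - 1 := by
    rw [hTinv, hT, add_add_sub_cancel, ht]
    generalize δ / a₂ = d at *
    field_simp
    ring
  set g : ℝ × ℝ → ℝ := fun z => (MvPolynomial.eval ![z.1, z.2] v) ^ 2 with hg
  have hgc : Continuous g := by
    refine (v.continuous_eval.comp (continuous_pi fun i => ?_)).pow 2
    fin_cases i
    · exact continuous_fst
    · exact continuous_snd
  have hgx : ∀ x : EuclideanSpace ℝ (Fin 2),
      (MvPolynomial.eval (fun i => x i) v) ^ 2 = g (x 0, x 1) := fun x => by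
    simp only [hg]
    congr 3
    ext i
    fin_cases i <;> rfl
  simp only [hgx]
  have hmem := mem_convexHull_triangle_iff ha₂ hc₁ hA0 hA1 hB hC0 hC1
  set Δ := convexHull ℝ ({A, B, C} : Set (EuclideanSpace ℝ (Fin 2))) with hΔ
  have hfull : ∫ x in Δ, g (x 0, x 1) = a₂ * ∫ y in (0 : ℝ)..c₁, ∫ s in (0 : ℝ)..1,
      s * g (a₁ * (1 - s) + y * s, a₂ * (1 - s)) := by
    have h := intervalIntegral_triangle_eq hgc (a₁ := a₁) (c₁ := c₁) ha₂ 0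
    rw [zero_div, sub_zero] at h
    rw [Set.ext hmem, ← h, intervalIntegral.integral_of_le ha₂.le,
      ← integral_Icc_eq_integral_Ioc]
    exact setIntegral_triangle_slab_eq hgc ha₂ hc₁ measurableSet_Icc subset_rfl
  have htrunc : a₂ * ∫ y in (0 : ℝ)..c₁, ∫ s in (0 : ℝ)..(1 - δ / a₂),
      s * g (a₁ * (1 - s) + y * s, a₂ * (1 - s)) ≤
        ∫ x in {x ∈ Δ | δ < Metric.infDist x (segment ℝ B C)}, g (x 0, x 1) := by
    rw [← intervalIntegral_triangle_eq hgc ha₂ δ, intervalIntegral.integral_of_le hδ.2.le,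
      ← setIntegral_triangle_slab_eq hgc ha₂ hc₁ measurableSet_Ioc
        (Set.Ioc_subset_Icc_self.trans (Set.Icc_subset_Icc_left hδ0.le))]
    have hcomp : IsCompact Δ := Set.Finite.isCompact_convexHull ℝ (Set.toFinite _)
    have hint : IntegrableOn (fun x : EuclideanSpace ℝ (Fin 2) => g (x 0, x 1)) Δ :=
      ContinuousOn.integrableOn_compact hcomp (by fun_prop)
    refine setIntegral_mono_set (hint.mono_set fun x hx => hx.1)
      (Filter.Eventually.of_forall fun x => sq_nonneg _)
      (LE.le.eventuallyLE fun x hx => ?_)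
    refine ⟨(hmem x).2 ⟨⟨hδ0.le.trans hx.1.1.le, hx.1.2⟩, hx.2⟩, hx.1.1.trans_le ?_⟩
    refine (Metric.le_infDist ⟨B, left_mem_segment _ _ _⟩).2 ?_
    rintro _ ⟨u, w, -, -, -, rfl⟩
    have h := PiLp.norm_apply_le (x - (u • B + w • C)) 1
    rw [← dist_eq_norm] at h
    refine le_trans ?_ h
    simp [hB, hC1, le_abs_self]
  have hmain : ∫ y in (0 : ℝ)..c₁, ∫ s in (0 : ℝ)..1,
      s * g (a₁ * (1 - s) + y * s, a₂ * (1 - s)) ≤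
        T ^ (2 * (2 * p) + 3) * ∫ y in (0 : ℝ)..c₁, ∫ s in (0 : ℝ)..(1 - δ / a₂),
          s * g (a₁ * (1 - s) + y * s, a₂ * (1 - s)) := by
    rw [← intervalIntegral.integral_const_mul]
    refine intervalIntegral.integral_mono_on hc₁.le
      (Continuous.intervalIntegrable (by fun_prop) _ _)
      (Continuous.intervalIntegrable (by fun_prop) _ _) fun y _ => ?_
    obtain ⟨q, hq, hqe⟩ := exists_polynomial_eval_eq_eval_line v hv ![a₁, a₂] ![y, 0]
    have hqg : ∀ s, g (a₁ * (1 - s) + y * s, a₂ * (1 - s)) = q.eval s ^ 2 := fun s => by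
      rw [hqe]
      simp only [hg]
      congr 3
      ext i
      fin_cases i <;> simp
    simp only [hqg]
    exact integral_mul_sq_le hq hη hT1 hTη
  have hfinal : ∫ x in Δ, g (x 0, x 1) ≤ T ^ (2 * (2 * p) + 3) *
      ∫ x in {x ∈ Δ | δ < Metric.infDist x (segment ℝ B C)}, g (x 0, x 1) := by
    rw [hfull]
    refine (mul_le_mul_of_nonneg_left hmain ha₂.le).trans ?_
    rw [mul_left_comm]
    exact mul_le_mul_of_nonneg_left htrunc (by positivity)
  have hnonneg : ∀ S : Set (EuclideanSpace ℝ (Fin 2)), 0 ≤ ∫ x in S, g (x 0, x 1) :=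
    fun S => integral_nonneg fun x => sq_nonneg _
  refine (Real.rpow_le_rpow (hnonneg _) hfinal (by norm_num)).trans_eq ?_
  rw [Real.mul_rpow (by positivity) (hnonneg _), ← Real.rpow_natCast,
    ← Real.rpow_mul (by linarith)]
  congr 2
  push_cast
  ring
end

section
/- Let Δ ⊂ ℝ² be a triangle and ρ_Δ the radius of its maximal inscribed circle. For any δ ∈ (0, ρ_Δ/2), let Δ_δ = {x ∈ Δ : dist(x, ∂Δ) > δ}. Then for every polynomial v of degree at most p in each variable, ‖v‖_{L²(Δ)} ≤ (1 + 7√(δ/ρ_Δ))^{2p + 3/2} ‖v‖_{L²(Δ_δ)}. -/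
open MeasureTheory

open Polynomial in
/-- Growth of a polynomial outside an interval on which it is bounded, from the extremality of the
Chebyshev polynomials. -/
theorem Polynomial.eval_one_le_of_abs_le_on_Icc {N : ℕ} {Q : ℝ[X]} (hQ : Q.natDegree ≤ N)
    {s M : ℝ} (hs0 : 0 ≤ s) (hs1 : s < 1) (hM : 0 < M)
    (hbd : ∀ t ∈ Set.Icc 0 (1 - s ^ 2), |Q.eval t| ≤ M) :
    Q.eval 1 ≤ ((1 + s) / (1 - s)) ^ N * M := by
  have hb : 0 < 1 - s ^ 2 := by nlinarith
  have hs' : 0 < 1 - s := by linarith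
  have hr : 0 < (1 + s) / (1 - s) := by positivity
  set y : ℝ := (1 + s ^ 2) / (1 - s ^ 2) with hy
  have hcosh : Real.cosh (Real.log ((1 + s) / (1 - s))) = y := by
    rw [Real.cosh_log hr, hy]
    have : (1 + s) ≠ 0 := by positivity
    have h2 : 1 - s ^ 2 = (1 - s) * (1 + s) := by ring
    rw [h2]
    field_simp
    ring
  have hy1 : 1 ≤ y := hcosh ▸ Real.one_le_cosh _
  set L : ℝ[X] := C ((1 - s ^ 2) / 2) * X + C ((1 - s ^ 2) / 2) with hL
  have hLe (x : ℝ) : L.eval x = (1 - s ^ 2) / 2 * (x + 1) := by simp [hL]; ring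
  set P : ℝ[X] := C M⁻¹ * Q.comp L with hP
  have hPe (x : ℝ) : P.eval x = M⁻¹ * Q.eval ((1 - s ^ 2) / 2 * (x + 1)) := by
    simp [hP, eval_comp, hLe]
  have hPdeg : P.degree ≤ N := by
    rw [← natDegree_le_iff_degree_le]
    refine (natDegree_C_mul_le _ _).trans (natDegree_comp_le.trans ?_)
    calc Q.natDegree * L.natDegree ≤ N * 1 := Nat.mul_le_mul hQ natDegree_linear_le
      _ = N := mul_one N
  have hPbnd : ∀ x ∈ Set.Icc (-1 : ℝ) 1, |P.eval x| ≤ 1 := by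
    intro x hx
    rw [hPe, abs_mul, abs_of_pos (inv_pos.2 hM), inv_mul_le_one₀ hM]
    exact hbd _ ⟨by nlinarith [hx.1], by nlinarith [hx.2]⟩
  have key := Polynomial.Chebyshev.eval_iterate_derivative_le_of_forall_abs_le_one
    (k := 0) hy1 hPdeg hPbnd
  simp only [Function.iterate_zero, id_eq] at key
  rw [← hcosh, Chebyshev.T_real_cosh, hcosh, hPe] at key
  have h1 : (1 - s ^ 2) / 2 * (y + 1) = 1 := by
    rw [hy]; field_simp; ring
  rw [h1] at key
  have h2 : Real.cosh (((N : ℤ) : ℝ) * Real.log ((1 + s) / (1 - s))) ≤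
      ((1 + s) / (1 - s)) ^ N := by
    have hlog : 0 ≤ Real.log ((1 + s) / (1 - s)) :=
      Real.log_nonneg (by rw [le_div_iff₀ hs']; linarith)
    have h3 : ((1 + s) / (1 - s)) ^ N = Real.exp ((N : ℝ) * Real.log ((1 + s) / (1 - s))) := by
      rw [Real.exp_nat_mul, Real.exp_log hr]
    rw [h3, Real.cosh_eq, Int.cast_natCast]
    have : Real.exp (-((N : ℝ) * Real.log ((1 + s) / (1 - s)))) ≤
        Real.exp ((N : ℝ) * Real.log ((1 + s) / (1 - s))) :=
      Real.exp_le_exp.2 (by nlinarith [mul_nonneg (Nat.cast_nonneg (α := ℝ) N) hlog])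
    linarith
  have := key.trans h2
  rwa [inv_mul_le_iff₀ hM, mul_comm] at this

theorem MvPolynomial.totalDegree_le_sum_degreeOf {σ R : Type*} [Fintype σ] [CommSemiring R]
    (v : MvPolynomial σ R) : v.totalDegree ≤ ∑ i, v.degreeOf i := by
  classical
  refine Finset.sup_le fun m hm => ?_
  rw [Finsupp.sum_fintype _ _ fun _ => rfl]
  exact Finset.sum_le_sum fun i _ => MvPolynomial.monomial_le_degreeOf i hm

theorem MvPolynomial.exists_polynomial_eval_homothety {n : ℕ} (v : MvPolynomial (Fin n) ℝ)
    (c x : EuclideanSpace ℝ (Fin n)) :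
    ∃ P : Polynomial ℝ, P.natDegree ≤ v.totalDegree ∧
      ∀ t : ℝ, P.eval t = MvPolynomial.eval (fun i => (AffineMap.homothety c t x) i) v := by
  refine ⟨MvPolynomial.aeval
    (fun i => Polynomial.C (x i - c i) * Polynomial.X + Polynomial.C (c i)) v, ?_, fun t => ?_⟩
  · exact (v.aeval_natDegree_le le_rfl _ fun i => Polynomial.natDegree_linear_le).trans_eq
      (mul_one _)
  · rw [← Polynomial.coe_aeval_eq_eval, MvPolynomial.comp_aeval_apply,
      MvPolynomial.aeval_eq_eval]
    congr 2
    ext i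
    simp [AffineMap.homothety_apply]
    ring

theorem MvPolynomial.continuous_eval_euclidean {n : ℕ} (v : MvPolynomial (Fin n) ℝ) :
    Continuous fun x : EuclideanSpace ℝ (Fin n) => MvPolynomial.eval (fun i => x i) v :=
  (MvPolynomial.continuous_eval v).comp (by fun_prop)

/-- The integral of the square of a polynomial precomposed with a homothety is polynomial in the
ratio of the homothety. -/
theorem MvPolynomial.exists_polynomial_integral_sq_homothety {n : ℕ}
    (v : MvPolynomial (Fin n) ℝ) (c : EuclideanSpace ℝ (Fin n))
    {K S : Set (EuclideanSpace ℝ (Fin n))} (hK : IsCompact K) (hS : S ⊆ K) :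
    ∃ Q : Polynomial ℝ, Q.natDegree ≤ 2 * v.totalDegree ∧
      ∀ t : ℝ, Q.eval t =
        ∫ x in S, (MvPolynomial.eval (fun i => (AffineMap.homothety c t x) i) v) ^ 2 := by
  set F : ℝ → EuclideanSpace ℝ (Fin n) → ℝ := fun t x =>
    (MvPolynomial.eval (fun i => (AffineMap.homothety c t x) i) v) ^ 2 with hF
  have hint (t : ℝ) : IntegrableOn (F t) S := by
    refine (ContinuousOn.integrableOn_compact hK ?_).mono_set hS
    exact ((v.continuous_eval_euclidean.comp
      (AffineMap.homothety_continuous c t)).pow 2).continuousOn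
  set s := Finset.range (2 * v.totalDegree + 1) with hs
  have hinj : Set.InjOn (fun j : ℕ => (j : ℝ)) s := Nat.cast_injective.injOn
  refine ⟨Lagrange.interpolate s (fun j : ℕ => (j : ℝ)) fun j => ∫ x in S, F j x, ?_, fun t => ?_⟩
  · rw [Polynomial.natDegree_le_iff_degree_le]
    have := Lagrange.degree_interpolate_le (fun j : ℕ => ∫ x in S, F j x) hinj
    simpa [hs] using this
  · have hFt (x) : F t x = ∑ j ∈ s, F j x *
        (Lagrange.basis s (fun j : ℕ => (j : ℝ)) j).eval t := by
      obtain ⟨P, hP, hPe⟩ := v.exists_polynomial_eval_homothety c x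
      have hdeg : (P ^ 2).degree < s.card := by
        rw [hs, Finset.card_range]
        refine lt_of_le_of_lt (Polynomial.natDegree_le_iff_degree_le.1
          (Polynomial.natDegree_pow_le_of_le 2 hP)) ?_
        exact_mod_cast Nat.lt_succ_self _
      have := congrArg (Polynomial.eval t) (Lagrange.eq_interpolate hinj hdeg)
      simpa [Lagrange.interpolate_apply, Polynomial.eval_finsetSum, hPe, hF] using this
    simp only [Lagrange.interpolate_apply, Polynomial.eval_finsetSum, Polynomial.eval_mul,
      Polynomial.eval_C]
    change _ = ∫ x in S, F t x
    rw [integral_congr_ae (Filter.Eventually.of_forall hFt),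
      integral_finsetSum s fun (j : ℕ) _ => (hint j).mul_const _]
    simp_rw [integral_mul_const]

theorem setIntegral_image_homothety {n : ℕ} (c : EuclideanSpace ℝ (Fin n))
    {S : Set (EuclideanSpace ℝ (Fin n))} (hS : MeasurableSet S) {t : ℝ} (ht : 0 < t)
    (g : EuclideanSpace ℝ (Fin n) → ℝ) :
    ∫ x in AffineMap.homothety c t '' S, g x =
      t ^ n * ∫ x in S, g (AffineMap.homothety c t x) := by
  have hd (x : EuclideanSpace ℝ (Fin n)) : HasFDerivAt (AffineMap.homothety c t)
      (t • ContinuousLinearMap.id ℝ (EuclideanSpace ℝ (Fin n))) x := by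
    have : (AffineMap.homothety c t : EuclideanSpace ℝ (Fin n) → EuclideanSpace ℝ (Fin n)) =
        fun x => t • (x - c) + c := by ext1 x; simp [AffineMap.homothety_apply]
    rw [this]
    exact (((hasFDerivAt_id x).sub_const c).const_smul t).add_const c
  rw [integral_image_eq_integral_abs_det_fderiv_smul volume hS
    (fun x _ => (hd x).hasFDerivWithinAt)
    (fun x _ y _ h => by simpa [AffineMap.homothety_apply, ht.ne'] using h)]
  have hdet : (t • ContinuousLinearMap.id ℝ (EuclideanSpace ℝ (Fin n))).det = t ^ n := by
    simp [ContinuousLinearMap.det]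
  simp_rw [hdet, abs_of_pos (pow_pos ht n), smul_eq_mul]
  exact integral_const_mul _ _

/-- If a convex set contains a closed ball of radius `ρ` around `c`, then shrinking its interior
towards `c` by the factor `1 - δ / ρ` gives points at distance more than `δ` from the frontier. -/
theorem homothety_image_interior_subset {E : Type*} [NormedAddCommGroup E] [NormedSpace ℝ E]
    {K : Set E} (hK : Convex ℝ K) (hfr : (frontier K).Nonempty) {c : E} {ρ δ : ℝ}
    (hc : Metric.closedBall c ρ ⊆ K) (hδ : 0 < δ) (hδρ : δ < ρ) :
    AffineMap.homothety c (1 - δ / ρ) '' interior K ⊆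
      {x ∈ K | δ < Metric.infDist x (frontier K)} := by
  rintro _ ⟨z, hz, rfl⟩
  have hρ : 0 < ρ := hδ.trans hδρ
  have hb : 0 < 1 - δ / ρ := by rw [sub_pos, div_lt_one hρ]; exact hδρ
  set b := 1 - δ / ρ with hbdef
  obtain ⟨η, hη, hball⟩ := Metric.isOpen_iff.1 isOpen_interior z hz
  set x := AffineMap.homothety c b z with hx
  have hsub : Metric.ball x (δ + b * η) ⊆ K := by
    intro w hw
    have hR : 0 < δ + b * η := by positivity
    set u : E := (δ + b * η)⁻¹ • (w - x) with hu
    have hun : ‖u‖ < 1 := by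
      rw [hu, norm_smul, norm_inv, Real.norm_of_nonneg hR.le, inv_mul_lt_one₀ hR]
      rwa [mem_ball_iff_norm] at hw
    have h1 : z + η • u ∈ K := interior_subset <| hball <| by
      rw [mem_ball_iff_norm, add_sub_cancel_left, norm_smul, Real.norm_of_nonneg hη.le]
      nlinarith
    have h2 : c + ρ • u ∈ K := hc <| by
      rw [mem_closedBall_iff_norm, add_sub_cancel_left, norm_smul, Real.norm_of_nonneg hρ.le]
      nlinarith
    have h3 := hK h1 h2 hb.le (show 0 ≤ δ / ρ by positivity) (by rw [hbdef]; ring)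
    have hwx : w = x + (δ + b * η) • u := by
      rw [hu, smul_inv_smul₀ hR.ne']; abel
    convert h3 using 1
    rw [hwx, hx, AffineMap.homothety_apply, vsub_eq_sub, vadd_eq_add, smul_add, smul_add,
      smul_smul (δ / ρ), div_mul_cancel₀ _ hρ.ne', show δ / ρ = 1 - b by rw [hbdef]; ring]
    module
  refine ⟨hsub (Metric.mem_ball_self (by positivity)), ?_⟩
  refine lt_of_lt_of_le (show δ < δ + b * η by nlinarith [mul_pos hb hη]) ?_
  refine (Metric.le_infDist hfr).2 fun y hy => ?_
  by_contra! hlt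
  refine hy.2 (interior_maximal hsub Metric.isOpen_ball ?_)
  rwa [Metric.mem_ball, dist_comm]

theorem homothety_image_subset_of_le {E : Type*} [NormedAddCommGroup E] [NormedSpace ℝ E]
    {S : Set E} (hS : Convex ℝ S) {c : E} (hc : c ∈ S) {t b : ℝ} (ht : 0 ≤ t) (htb : t ≤ b)
    (hb : 0 < b) : AffineMap.homothety c t '' S ⊆ AffineMap.homothety c b '' S := by
  rintro _ ⟨x, hx, rfl⟩
  refine ⟨AffineMap.homothety c (t / b) x, ?_, ?_⟩
  · have := hS hx hc (show 0 ≤ t / b by positivity)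
      (show 0 ≤ 1 - t / b by rw [sub_nonneg, div_le_one hb]; exact htb) (by ring)
    convert this using 1
    rw [AffineMap.homothety_apply, vsub_eq_sub, vadd_eq_add]
    module
  · rw [← AffineMap.homothety_mul_apply, mul_div_cancel₀ _ hb.ne']

/-- Domain inverse estimate on a compact convex planar set containing a disc of radius `ρ`. -/
theorem setIntegral_sq_le_of_convex {d : ℕ} {K : Set (EuclideanSpace ℝ (Fin 2))}
    (hKc : IsCompact K) (hK : Convex ℝ K) {c : EuclideanSpace ℝ (Fin 2)} {ρ δ : ℝ}
    (hc : Metric.closedBall c ρ ⊆ K) (hδ : 0 < δ) (hδρ : δ < ρ)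
    (v : MvPolynomial (Fin 2) ℝ) (hv : v.totalDegree ≤ d) :
    ∫ x in K, (MvPolynomial.eval (fun i => x i) v) ^ 2 ≤
      ((1 + √(δ / ρ)) / (1 - √(δ / ρ))) ^ (2 * d + 2) *
        ∫ x in {x ∈ K | δ < Metric.infDist x (frontier K)},
          (MvPolynomial.eval (fun i => x i) v) ^ 2 := by
  have hρ : 0 < ρ := hδ.trans hδρ
  set g : EuclideanSpace ℝ (Fin 2) → ℝ := fun x => (MvPolynomial.eval (fun i => x i) v) ^ 2
    with hg
  have hgc : Continuous g := v.continuous_eval_euclidean.pow 2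
  have hg0 (x) : 0 ≤ g x := sq_nonneg _
  have hgK : IntegrableOn g K := hgc.continuousOn.integrableOn_compact hKc
  set s := √(δ / ρ) with hs
  have hs2 : s ^ 2 = δ / ρ := Real.sq_sqrt (by positivity)
  have hs0 : 0 ≤ s := Real.sqrt_nonneg _
  have hε1 : δ / ρ < 1 := (div_lt_one hρ).2 hδρ
  have hs1 : s < 1 := by nlinarith
  have hb : 0 < 1 - δ / ρ := by linarith
  have hcint : c ∈ interior K := interior_mono hc
    (by rw [interior_closedBall _ hρ.ne']; exact Metric.mem_ball_self hρ)
  have hfr : (frontier K).Nonempty := by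
    rw [nonempty_frontier_iff]
    exact ⟨⟨c, interior_subset hcint⟩, hKc.ne_univ⟩
  set D := {x ∈ K | δ < Metric.infDist x (frontier K)} with hD
  have hDm : MeasurableSet D := hKc.measurableSet.inter
    (measurableSet_lt measurable_const (Metric.continuous_infDist_pt _).measurable)
  obtain ⟨Q, hQd, hQ⟩ := v.exists_polynomial_integral_sq_homothety c hKc interior_subset
  have hS : MeasurableSet (interior K) := isOpen_interior.measurableSet
  set R := Polynomial.X ^ 2 * Q with hR
  have hRd : R.natDegree ≤ 2 * d + 2 := by
    refine Polynomial.natDegree_mul_le.trans ?_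
    rw [Polynomial.natDegree_X_pow]
    omega
  have hReval {t : ℝ} (ht : 0 < t) :
      R.eval t = ∫ x in AffineMap.homothety c t '' interior K, g x := by
    rw [setIntegral_image_homothety c hS ht, hR]
    simp [hQ, hg]
  have hR1 : R.eval 1 = ∫ x in K, g x := by
    rw [hReval one_pos, AffineMap.homothety_one]
    simp only [AffineMap.coe_id, Set.image_id]
    exact setIntegral_congr_set (interior_ae_eq_of_null_frontier (hK.addHaar_frontier volume))
  have hDK : D ⊆ K := fun x hx => hx.1
  have hbd : ∀ t ∈ Set.Icc 0 (1 - s ^ 2), |R.eval t| ≤ ∫ x in D, g x := by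
    rintro t ⟨ht0, htb⟩
    rw [hs2] at htb
    rcases ht0.eq_or_lt with rfl | ht
    · simpa [hR] using integral_nonneg hg0
    · rw [hReval ht, abs_of_nonneg (integral_nonneg hg0)]
      refine setIntegral_mono_set (hgK.mono_set hDK) (Filter.Eventually.of_forall hg0)
        (LE.le.eventuallyLE ?_)
      exact (homothety_image_subset_of_le hK.interior hcint ht0 htb hb).trans
        (homothety_image_interior_subset hK hfr hc hδ hδρ)
  rw [← hR1]
  have hJ : 0 ≤ ∫ x in D, g x := integral_nonneg hg0
  have hr : 0 < ((1 + s) / (1 - s)) ^ (2 * d + 2) := by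
    have : 0 < 1 - s := by linarith
    positivity
  refine le_of_forall_pos_le_add fun η hη => ?_
  have := Polynomial.eval_one_le_of_abs_le_on_Icc hRd hs0 hs1
    (M := (∫ x in D, g x) + η / ((1 + s) / (1 - s)) ^ (2 * d + 2)) (by positivity)
    fun t ht => (hbd t ht).trans (le_add_of_nonneg_right (by positivity))
  rwa [mul_add, mul_div_cancel₀ _ hr.ne'] at this

/-- Domain inverse estimate on a general triangle (Lemma 2.4): `Δ` is a (nondegenerate)
triangle with inradius `ρ`, `δ ∈ (0, ρ/2)`, and `Δ_δ = {x ∈ Δ : dist(x,∂Δ) > δ}`. Then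
every polynomial `v` of degree at most `p` in each variable satisfies
`‖v‖_{L²(Δ)} ≤ (1 + 7√(δ/ρ))^{2p+3/2} ‖v‖_{L²(Δ_δ)}`. -/
theorem domain_inverse_estimate_triangle (p : ℕ)
    (A B C : EuclideanSpace ℝ (Fin 2)) (hABC : AffineIndependent ℝ ![A, B, C])
    (ρ δ : ℝ)
    (hρ : IsGreatest {r : ℝ | ∃ c : EuclideanSpace ℝ (Fin 2),
      Metric.closedBall c r ⊆ convexHull ℝ ({A, B, C} : Set (EuclideanSpace ℝ (Fin 2)))} ρ)
    (hδ : δ ∈ Set.Ioo 0 (ρ / 2))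
    (v : MvPolynomial (Fin 2) ℝ) (hv : ∀ i, v.degreeOf i ≤ p) :
    (∫ x in convexHull ℝ ({A, B, C} : Set (EuclideanSpace ℝ (Fin 2))),
        (MvPolynomial.eval (fun i => x i) v) ^ 2) ^ ((1:ℝ)/2) ≤
      (1 + 7 * Real.sqrt (δ / ρ)) ^ ((2 * p : ℝ) + 3/2) *
        (∫ x in {x ∈ convexHull ℝ ({A, B, C} : Set (EuclideanSpace ℝ (Fin 2))) |
            δ < Metric.infDist x
              (frontier (convexHull ℝ ({A, B, C} : Set (EuclideanSpace ℝ (Fin 2)))))},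
          (MvPolynomial.eval (fun i => x i) v) ^ 2) ^ ((1:ℝ)/2) := by
  obtain ⟨c, hc⟩ := hρ.1
  obtain ⟨hδ0, hδρ⟩ := hδ
  have hρ0 : 0 < ρ := by linarith
  set K := convexHull ℝ ({A, B, C} : Set (EuclideanSpace ℝ (Fin 2)))
  have hv' : v.totalDegree ≤ 2 * p := by
    refine v.totalDegree_le_sum_degreeOf.trans ?_
    rw [Fin.sum_univ_two]
    linarith [hv 0, hv 1]
  have hKc : IsCompact K := (Set.toFinite _).isCompact_convexHull ℝ
  have key := setIntegral_sq_le_of_convex hKc (convex_convexHull ℝ _) hc hδ0 (by linarith) v hv'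
  set I := ∫ x in K, (MvPolynomial.eval (fun i => x i) v) ^ 2
  set J := ∫ x in {x ∈ K | δ < Metric.infDist x (frontier K)},
    (MvPolynomial.eval (fun i => x i) v) ^ 2
  have hI : 0 ≤ I := integral_nonneg fun _ => sq_nonneg _
  have hJ : 0 ≤ J := integral_nonneg fun _ => sq_nonneg _
  set s := √(δ / ρ)
  have hs2 : s ^ 2 = δ / ρ := Real.sq_sqrt (by positivity)
  have hs0 : 0 ≤ s := Real.sqrt_nonneg _
  have hε : s ^ 2 < 1 / 2 := by rw [hs2, div_lt_iff₀ hρ0]; linarith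
  have hs : s ≤ 5 / 7 := by nlinarith
  have hr : (1 + s) / (1 - s) ≤ 1 + 7 * s := by
    rw [div_le_iff₀ (by linarith)]
    nlinarith
  have hr0 : 0 ≤ (1 + s) / (1 - s) := div_nonneg (by linarith) (by linarith)
  have hIJ : I ≤ (1 + 7 * s) ^ (4 * p + 3) * J := by
    refine key.trans (mul_le_mul_of_nonneg_right ?_ hJ)
    calc ((1 + s) / (1 - s)) ^ (2 * (2 * p) + 2)
        ≤ (1 + 7 * s) ^ (2 * (2 * p) + 2) := pow_le_pow_left₀ hr0 hr _
      _ ≤ (1 + 7 * s) ^ (4 * p + 3) := pow_le_pow_right₀ (by linarith) (by omega)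
  calc I ^ ((1:ℝ)/2) ≤ ((1 + 7 * s) ^ (4 * p + 3) * J) ^ ((1:ℝ)/2) :=
        Real.rpow_le_rpow hI hIJ (by norm_num)
    _ = (1 + 7 * s) ^ ((2 * p : ℝ) + 3/2) * J ^ ((1:ℝ)/2) := by
        rw [Real.mul_rpow (by positivity) hJ, ← Real.rpow_natCast,
          ← Real.rpow_mul (by positivity)]
        congr 2
        push_cast
        ring
end
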